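/- For every fixed natural number j, the Sobolev-type Jacobi orthogonal polynomials satisfy lim_{n→∞} (Q_n^{M,N})^{(j)}(−1) / (P̃_n^{(α,β)})^{(j)}(−1) = j(j−1) / ((β+j+1)(β+j+2)). -/

import Mathlib

open MeasureTheory Polynomial Filter

section RegularVariation

/-- The sequence `b` is eventually positive and `n (b (n + 1) / b n - 1)` tends to `c`, so that
`b` grows like `n ^ c` up to slowly varying factors. -/
def HasGrowthIndex (b : ℕ → ℝ) (c : ℝ) : Prop :=
  (∀ᶠ n in atTop, 0 < b n) ∧ Tendsto (fun n : ℕ => (n : ℝ) * (b (n + 1) / b n - 1)) atTop (nhds c)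

theorem HasGrowthIndex.tendsto_ratio {b : ℕ → ℝ} {c : ℝ} (h : HasGrowthIndex b c) :
    Tendsto (fun n : ℕ => b (n + 1) / b n) atTop (nhds 1) := by
  have h1 := (h.2.mul tendsto_one_div_atTop_nhds_zero_nat).add_const 1
  simp only [mul_zero, zero_add] at h1
  refine h1.congr' ?_
  filter_upwards [eventually_gt_atTop 0] with n hn
  have : (n : ℝ) ≠ 0 := by positivity
  field_simp
  ring

theorem HasGrowthIndex.mul {b b' : ℕ → ℝ} {c c' : ℝ} (h : HasGrowthIndex b c)
    (h' : HasGrowthIndex b' c') : HasGrowthIndex (fun n => b n * b' n) (c + c') := by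
  refine ⟨by filter_upwards [h.1, h'.1] with n h1 h2 using mul_pos h1 h2, ?_⟩
  have := (h.2.mul h'.tendsto_ratio).add h'.2
  rw [mul_one] at this
  refine this.congr fun n => ?_
  rw [mul_div_mul_comm]
  ring

theorem HasGrowthIndex.one : HasGrowthIndex (fun _ => 1) 0 :=
  ⟨by simp, by simp⟩

theorem HasGrowthIndex.tendsto_increment_div {b : ℕ → ℝ} {c : ℝ} (h : HasGrowthIndex b c) :
    Tendsto (fun n : ℕ => (((n + 1 : ℕ) : ℝ) * b (n + 1) - n * b n) / b n) atTop
      (nhds (c + 1)) := by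
  have := h.2.add h.tendsto_ratio
  refine this.congr' ?_
  filter_upwards [h.1] with n hn
  push_cast
  field_simp
  ring

theorem HasGrowthIndex.tendsto_sum_atTop {b : ℕ → ℝ} {c : ℝ} (h : HasGrowthIndex b c)
    (hc : -1 < c) (hb : ∀ n, 0 ≤ b n) :
    Tendsto (fun n => ∑ k ∈ Finset.range n, b k) atTop atTop := by
  obtain ⟨n₀, hn₀⟩ := eventually_atTop.1 (h.1.and
    (h.tendsto_increment_div.eventually (lt_mem_nhds (show 0 < c + 1 by linarith))))
  set m := n₀ + 1
  have hmono : ∀ n, m ≤ n → (m : ℝ) * b m ≤ n * b n := by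
    intro n hn
    induction n, hn using Nat.le_induction with
    | base => exact le_rfl
    | succ n hn ih =>
      obtain ⟨h1, h2⟩ := hn₀ n (by omega)
      have := (div_pos_iff_of_pos_right h1).1 h2
      linarith
  have hpos : 0 < (m : ℝ) * b m := mul_pos (by positivity) (hn₀ m (by omega)).1
  refine (not_summable_iff_tendsto_nat_atTop_of_nonneg hb).1 fun hs => ?_
  have h1 : Summable fun n : ℕ => (m : ℝ) * b m * (1 / ((n + m : ℕ) : ℝ)) := by
    refine Summable.of_nonneg_of_le (fun n => by positivity) (fun n => ?_)
      ((summable_nat_add_iff m).2 hs)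
    have h2 := hmono (n + m) (by omega)
    have h3 : (0 : ℝ) < ((n + m : ℕ) : ℝ) := by positivity
    rw [mul_one_div, div_le_iff₀ h3]
    linarith
  rw [summable_mul_left_iff hpos.ne'] at h1
  exact Real.not_summable_one_div_natCast ((summable_nat_add_iff m).1 h1)

theorem HasGrowthIndex.tendsto_mul_div_sum {b : ℕ → ℝ} {c : ℝ} (h : HasGrowthIndex b c)
    (hc : -1 < c) (hb : ∀ n, 0 ≤ b n) :
    Tendsto (fun n : ℕ => n * b n / ∑ k ∈ Finset.range n, b k) atTop (nhds (c + 1)) := by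
  have hS := h.tendsto_sum_atTop hc hb
  have h1 : (fun n : ℕ => (((n + 1 : ℕ) : ℝ) * b (n + 1) - n * b n) - (c + 1) * b n)
      =o[atTop] b := by
    rw [Asymptotics.isLittleO_iff_tendsto' (h.1.mono fun n hn h0 => absurd h0 hn.ne')]
    have := h.tendsto_increment_div.sub_const (c + 1)
    rw [sub_self] at this
    refine this.congr' ?_
    filter_upwards [h.1] with n hn
    field_simp
  have h2 := (h1.sum_range hb hS).tendsto_div_nhds_zero.add_const (c + 1)
  rw [zero_add] at h2
  refine h2.congr' ?_
  filter_upwards [hS.eventually_gt_atTop 0] with n hn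
  rw [Finset.sum_sub_distrib, ← Finset.mul_sum,
    Finset.sum_range_sub (fun k : ℕ => (k : ℝ) * b k)]
  field_simp
  simp

theorem HasGrowthIndex.tendsto_sum_div_mul {b : ℕ → ℝ} {c : ℝ} (h : HasGrowthIndex b c)
    (hc : -1 < c) (hb : ∀ n, 0 ≤ b n) :
    Tendsto (fun n : ℕ => (∑ k ∈ Finset.range n, b k) / (n * b n)) atTop
      (nhds (1 / (c + 1))) := by
  rw [one_div]
  exact ((h.tendsto_mul_div_sum hc hb).inv₀ (by linarith)).congr fun n => inv_div _ _

theorem HasGrowthIndex.tendsto_mul_atTop {b : ℕ → ℝ} {c : ℝ} (h : HasGrowthIndex b c)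
    (hc : -1 < c) (hb : ∀ n, 0 ≤ b n) :
    Tendsto (fun n : ℕ => (n : ℝ) * b n) atTop atTop := by
  have hS := h.tendsto_sum_atTop hc hb
  refine ((h.tendsto_mul_div_sum hc hb).pos_mul_atTop (by linarith) hS).congr' ?_
  filter_upwards [hS.eventually_gt_atTop 0] with n hn
  field_simp

end RegularVariation

section JacobiWeight

/-- The weight `(1 - x) ^ α * (1 + x) ^ β` multiplied by a polynomial is integrable. -/
theorem intervalIntegrable_eval_mul_jacobiWeight {α β : ℝ} (hα : -1 < α) (hβ : -1 < β)
    (p : ℝ[X]) :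
    IntervalIntegrable (fun x => p.eval x * ((1 - x) ^ α * (1 + x) ^ β)) volume (-1) 1 := by
  have h1 : IntervalIntegrable (fun x : ℝ => (1 - x) ^ α * (1 + x) ^ β) volume (-1) 0 := by
    have h : IntervalIntegrable (fun x : ℝ => (1 + x) ^ β) volume (-1) 0 := by
      have := (intervalIntegral.intervalIntegrable_rpow' (a := 0) (b := 1) hβ).comp_add_left 1
      simpa using this
    refine h.continuousOn_mul ?_
    refine ContinuousOn.rpow_const (by fun_prop) fun x hx => Or.inl ?_
    rw [Set.uIcc_of_le (by norm_num)] at hx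
    linarith [hx.2]
  have h2 : IntervalIntegrable (fun x : ℝ => (1 - x) ^ α * (1 + x) ^ β) volume 0 1 := by
    have h : IntervalIntegrable (fun x : ℝ => (1 - x) ^ α) volume 0 1 := by
      have := (intervalIntegral.intervalIntegrable_rpow' (a := 1) (b := 0) hα).comp_sub_left 1
      simpa using this
    refine h.mul_continuousOn ?_
    refine ContinuousOn.rpow_const (by fun_prop) fun x hx => Or.inl ?_
    rw [Set.uIcc_of_le (by norm_num)] at hx
    linarith [hx.1]
  exact (h1.trans h2).continuousOn_mul p.continuous.continuousOn

theorem integrableOn_eval_mul_jacobiWeight {α β : ℝ} (hα : -1 < α) (hβ : -1 < β) (p : ℝ[X]) :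
    IntegrableOn (fun x => p.eval x * ((1 - x) ^ α * (1 + x) ^ β)) (Set.Ioo (-1) 1) :=
  (intervalIntegrable_iff_integrableOn_Ioo_of_le (by norm_num)).1
    (intervalIntegrable_eval_mul_jacobiWeight hα hβ p)

/-- Integration of polynomials against the Jacobi weight. -/
noncomputable def jacobiFunctional {α β : ℝ} (hα : -1 < α) (hβ : -1 < β) : ℝ[X] →ₗ[ℝ] ℝ where
  toFun p := ∫ x in Set.Ioo (-1 : ℝ) 1, p.eval x * ((1 - x) ^ α * (1 + x) ^ β)
  map_add' p q := by
    simp only [eval_add, add_mul]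
    exact integral_add (integrableOn_eval_mul_jacobiWeight hα hβ p)
      (integrableOn_eval_mul_jacobiWeight hα hβ q)
  map_smul' c p := by
    simp only [eval_smul, smul_eq_mul, mul_assoc, RingHom.id_apply]
    exact integral_const_mul _ _

theorem jacobiFunctional_mul_self_pos {α β : ℝ} (hα : -1 < α) (hβ : -1 < β) {p : ℝ[X]}
    (hp : p ≠ 0) : 0 < jacobiFunctional hα hβ (p * p) := by
  change 0 < ∫ x in Set.Ioo (-1 : ℝ) 1, (p * p).eval x * ((1 - x) ^ α * (1 + x) ^ β)
  have hw : ∀ x ∈ Set.Ioo (-1 : ℝ) 1, 0 < (1 - x) ^ α * (1 + x) ^ β := fun x hx =>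
    mul_pos (Real.rpow_pos_of_pos (by linarith [hx.2]) _)
      (Real.rpow_pos_of_pos (by linarith [hx.1]) _)
  rw [setIntegral_pos_iff_support_of_nonneg_ae ?_
    (integrableOn_eval_mul_jacobiWeight hα hβ (p * p))]
  · have hsub : Set.Ioo (-1 : ℝ) 1 \ (p.roots.toFinset : Set ℝ) ⊆
        Function.support (fun x => (p * p).eval x * ((1 - x) ^ α * (1 + x) ^ β))
          ∩ Set.Ioo (-1) 1 := by
      rintro x ⟨hx, hxp⟩
      refine ⟨?_, hx⟩
      have : p.eval x ≠ 0 := by simpa [hp] using hxp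
      simp only [Function.mem_support, eval_mul]
      exact mul_ne_zero (mul_ne_zero this this) (hw x hx).ne'
    refine lt_of_lt_of_le ?_ (measure_mono hsub)
    rw [measure_sdiff_null ((Finset.finite_toSet _).measure_zero _)]
    simp
  · filter_upwards [ae_restrict_mem measurableSet_Ioo] with x hx
    simp only [eval_mul, Pi.zero_apply]
    exact mul_nonneg (mul_self_nonneg _) (hw x hx).le

/-- Integration by parts (the Pearson equation of the Jacobi weight). -/
theorem jacobiFunctional_pearson {α β : ℝ} (hα : -1 < α) (hβ : -1 < β) (p : ℝ[X]) :
    jacobiFunctional hα hβ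
      ((1 - X ^ 2) * derivative p + (C (β - α) - C (α + β + 2) * X) * p) = 0 := by
  set q := (1 - X ^ 2) * derivative p + (C (β - α) - C (α + β + 2) * X) * p with hq
  change ∫ x in Set.Ioo (-1 : ℝ) 1, q.eval x * ((1 - x) ^ α * (1 + x) ^ β) = 0
  rw [← integral_Ioc_eq_integral_Ioo, ← intervalIntegral.integral_of_le (by norm_num)]
  rw [intervalIntegral.integral_eq_sub_of_hasDerivAt_of_le (by norm_num)
    (f := fun x => p.eval x * ((1 - x) ^ (α + 1) * (1 + x) ^ (β + 1))) ?_ ?_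
    (intervalIntegrable_eval_mul_jacobiWeight hα hβ q)]
  · norm_num [Real.zero_rpow (show α + 1 ≠ 0 by linarith),
      Real.zero_rpow (show β + 1 ≠ 0 by linarith)]
  · refine p.continuous.continuousOn.mul (ContinuousOn.mul ?_ ?_)
    · exact ContinuousOn.rpow_const (by fun_prop) fun x _ => Or.inr (by linarith)
    · exact ContinuousOn.rpow_const (by fun_prop) fun x _ => Or.inr (by linarith)
  · intro x hx
    have hx1 : 0 < 1 - x := by linarith [hx.2]
    have hx2 : 0 < 1 + x := by linarith [hx.1]
    have h1 := ((hasDerivAt_id x).const_sub 1).rpow_const (p := α + 1) (Or.inl hx1.ne')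
    have h2 := ((hasDerivAt_id x).const_add 1).rpow_const (p := β + 1) (Or.inl hx2.ne')
    refine ((p.hasDerivAt x).mul (h1.mul h2)).congr_deriv ?_
    simp only [id, add_sub_cancel_right, Real.rpow_add_one hx1.ne', Real.rpow_add_one hx2.ne', hq,
      eval_add, eval_mul, eval_sub, eval_one, eval_pow, eval_X, eval_C, Pi.mul_apply]
    ring

end JacobiWeight

section OrthogonalPolynomials

/-- `R` is the sequence of orthogonal polynomials of the functional `L`, with `R n` of exact
degree `n`. -/
structure IsOrthogonalSequence (L : ℝ[X] →ₗ[ℝ] ℝ) (R : ℕ → ℝ[X]) : Prop where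
  ne_zero : ∀ n, R n ≠ 0
  natDegree_eq : ∀ n, (R n).natDegree = n
  orthogonal : ∀ n : ℕ, ∀ q : ℝ[X], q.degree < n → L (R n * q) = 0

namespace IsOrthogonalSequence

variable {L : ℝ[X] →ₗ[ℝ] ℝ} {R : ℕ → ℝ[X]}

theorem degree_eq (hR : IsOrthogonalSequence L R) (n : ℕ) : (R n).degree = n := by
  rw [degree_eq_natDegree (hR.ne_zero n), hR.natDegree_eq]

theorem apply_mul_of_ne (hR : IsOrthogonalSequence L R) {m n : ℕ} (h : m ≠ n) :
    L (R m * R n) = 0 := by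
  rcases lt_or_gt_of_ne h with h | h
  · rw [mul_comm]
    exact hR.orthogonal n _ (by rw [hR.degree_eq]; exact_mod_cast h)
  · exact hR.orthogonal m _ (by rw [hR.degree_eq]; exact_mod_cast h)

theorem exists_eq_sum (hR : IsOrthogonalSequence L R) (n : ℕ) (p : ℝ[X]) (hp : p.degree < n) :
    ∃ c : ℕ → ℝ, p = ∑ k ∈ Finset.range n, c k • R k := by
  induction n generalizing p with
  | zero => exact ⟨0, by simpa using hp⟩
  | succ n ih =>
    have hlead : (R n).coeff n ≠ 0 := by
      have := leadingCoeff_ne_zero.2 (hR.ne_zero n)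
      rwa [leadingCoeff, hR.natDegree_eq] at this
    set a := p.coeff n / (R n).coeff n
    have hdeg : (p - a • R n).degree < n := by
      rw [degree_lt_iff_coeff_zero]
      intro m hm
      rcases hm.eq_or_lt with rfl | hm
      · simp [a, hlead]
      · rw [coeff_sub, coeff_smul, coeff_eq_zero_of_degree_lt (hp.trans_le (by exact_mod_cast hm)),
          coeff_eq_zero_of_natDegree_lt (by rwa [hR.natDegree_eq])]
        simp
    obtain ⟨c, hc⟩ := ih _ hdeg
    refine ⟨fun k => if k < n then c k else a, ?_⟩
    simp only [Finset.sum_range_succ, if_neg (lt_irrefl n)]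
    rw [← sub_eq_iff_eq_add, hc]
    exact Finset.sum_congr rfl fun k hk => by rw [if_pos (Finset.mem_range.1 hk)]

theorem eq_sum (hR : IsOrthogonalSequence L R) (hL : ∀ p : ℝ[X], p ≠ 0 → 0 < L (p * p))
    (n : ℕ) (p : ℝ[X]) (hp : p.degree < n) :
    p = ∑ k ∈ Finset.range n, (L (p * R k) / L (R k * R k)) • R k := by
  obtain ⟨c, hc⟩ := hR.exists_eq_sum n p hp
  have hcoeff : ∀ k ∈ Finset.range n, L (p * R k) / L (R k * R k) = c k := by
    intro k hk
    rw [div_eq_iff (hL _ (hR.ne_zero k)).ne', hc, Finset.sum_mul, map_sum,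
      Finset.sum_eq_single_of_mem k hk]
    · simp
    · intro m _ hm
      simp [hR.apply_mul_of_ne hm]
  rw [Finset.sum_congr rfl fun k hk => by rw [hcoeff k hk]]
  exact hc

/-- The three-term recurrence. -/
theorem mul_eq (hR : IsOrthogonalSequence L R) (hL : ∀ p : ℝ[X], p ≠ 0 → 0 < L (p * p))
    (n : ℕ) : ∃ b : ℝ, (X + 1) * R (n + 1) =
      (L ((X + 1) * R (n + 1) * R (n + 2)) / L (R (n + 2) * R (n + 2))) • R (n + 2)
        + b • R (n + 1)
        + (L ((X + 1) * R n * R (n + 1)) / L (R n * R n)) • R n := by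
  have hX : (X + 1 : ℝ[X]).degree = 1 := degree_X_add_C (1 : ℝ)
  have hdeg : ((X + 1) * R (n + 1)).degree < ((n + 3 : ℕ) : WithBot ℕ) := by
    rw [degree_mul, hX, hR.degree_eq]
    norm_cast
    omega
  refine ⟨L ((X + 1) * R (n + 1) * R (n + 1)) / L (R (n + 1) * R (n + 1)), ?_⟩
  conv_lhs => rw [hR.eq_sum hL _ _ hdeg]
  rw [Finset.sum_range_succ, Finset.sum_range_succ, Finset.sum_range_succ,
    Finset.sum_eq_zero, zero_add,
    show (X + 1) * R (n + 1) * R n = (X + 1) * R n * R (n + 1) by ring]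
  · abel
  · intro k hk
    rw [show (X + 1) * R (n + 1) * R k = R (n + 1) * ((X + 1) * R k) by ring,
      hR.orthogonal, zero_div, zero_smul]
    rw [degree_mul, hX, hR.degree_eq]
    have := Finset.mem_range.1 hk
    norm_cast
    omega

theorem smul (hR : IsOrthogonalSequence L R) {c : ℕ → ℝ} (hc : ∀ n, c n ≠ 0) :
    IsOrthogonalSequence L fun n => c n • R n where
  ne_zero n := smul_ne_zero (hc n) (hR.ne_zero n)
  natDegree_eq n := by rw [natDegree_smul _ (hc n), hR.natDegree_eq]
  orthogonal n q hq := by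
    rw [smul_mul_assoc, map_smul, hR.orthogonal n q hq, smul_zero]

end IsOrthogonalSequence

end OrthogonalPolynomials

section JacobiOperator

/-- The Jacobi differential operator, with `s = α + β + 1`. -/
noncomputable def jacobiOperator (s d : ℝ) (p : ℝ[X]) : ℝ[X] :=
  (1 - X ^ 2) * derivative (derivative p) + (C d - C (s + 1) * X) * derivative p

theorem coeff_jacobiOperator (s d : ℝ) (p : ℝ[X]) (m : ℕ) :
    (jacobiOperator s d p).coeff m = (m + 2) * (m + 1) * p.coeff (m + 2)
      + d * (m + 1) * p.coeff (m + 1) - m * (m + s) * p.coeff m := by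
  have h : jacobiOperator s d p = derivative (derivative p) - X * (X * derivative (derivative p))
      + C d * derivative p - C (s + 1) * (X * derivative p) := by
    rw [jacobiOperator]
    ring
  rw [h]
  rcases m with _ | _ | m <;>
    simp only [coeff_sub, coeff_add, coeff_C_mul, coeff_X_mul, mul_coeff_zero, coeff_C_zero,
      coeff_X_zero, coeff_derivative] <;> push_cast <;> ring

theorem degree_jacobiOperator_lt {s d : ℝ} {p : ℝ[X]} {n : ℕ} (hp : p.degree < n) :
    (jacobiOperator s d p).degree < n := by
  rw [degree_lt_iff_coeff_zero] at hp ⊢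
  intro m hm
  rw [coeff_jacobiOperator, hp m hm, hp (m + 1) (by omega), hp (m + 2) (by omega)]
  simp

theorem iterate_derivative_jacobiOperator (s d : ℝ) (p : ℝ[X]) (j : ℕ) :
    derivative^[j] (jacobiOperator s d p) = (1 - X ^ 2) * derivative^[j + 2] p
      + (C d - C (s + 1 + 2 * j) * X) * derivative^[j + 1] p - C (j * (j + s)) * derivative^[j] p := by
  induction j with
  | zero => simp [jacobiOperator]
  | succ j ih =>
    rw [Function.iterate_succ_apply', ih]
    simp only [derivative_sub, derivative_add, derivative_mul, derivative_C, derivative_X,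
      derivative_one, derivative_X_pow, ← Function.iterate_succ_apply' derivative]
    push_cast
    simp only [C_add, C_mul, C_1, map_natCast, map_ofNat]
    ring

/-- The products of eigenvalue gaps that express the derivatives of Jacobi polynomials at an
endpoint. -/
noncomputable def jacobiEndpointFactor (s β : ℝ) (j n : ℕ) : ℝ :=
  ∏ l ∈ Finset.range j, ((n : ℝ) * (n + s) - l * (l + s)) / (2 * (β + 1 + l))

theorem jacobiEndpointFactor_nonneg {s β : ℝ} (hs : -1 < s) (hβ : -1 < β) (j n : ℕ) :
    0 ≤ jacobiEndpointFactor s β j n := by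
  by_cases h : n < j
  · exact (Finset.prod_eq_zero (Finset.mem_range.2 h) (by simp)).ge
  · refine Finset.prod_nonneg fun l hl => ?_
    have hl' : l + 1 ≤ n := by have := Finset.mem_range.1 hl; omega
    have hln : (l : ℝ) + 1 ≤ n := by exact_mod_cast hl'
    have h0 : (0 : ℝ) ≤ l := by positivity
    refine div_nonneg ?_ (by linarith)
    rw [show (n : ℝ) * (n + s) - l * (l + s) = (n - l) * (n + l + s) by ring]
    exact mul_nonneg (by linarith) (by linarith)

theorem hasGrowthIndex_jacobiEndpointFactor {s β : ℝ} (hs : -1 < s) (hβ : -1 < β) (j : ℕ) :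
    HasGrowthIndex (jacobiEndpointFactor s β j) (2 * j) := by
  induction j with
  | zero =>
    rw [show jacobiEndpointFactor s β 0 = fun _ => 1 by ext; simp [jacobiEndpointFactor]]
    simpa using HasGrowthIndex.one
  | succ j ih =>
    have h : HasGrowthIndex
        (fun n : ℕ => ((n : ℝ) * (n + s) - j * (j + s)) / (2 * (β + 1 + j))) 2 := by
      have hj : (0 : ℝ) ≤ j := by positivity
      constructor
      · filter_upwards [eventually_gt_atTop j] with n hn
        have hln : (j : ℝ) + 1 ≤ n := by exact_mod_cast hn
        refine div_pos ?_ (by linarith)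
        rw [show (n : ℝ) * (n + s) - j * (j + s) = (n - j) * (n + j + s) by ring]
        exact mul_pos (by linarith) (by linarith)
      · have hinv := tendsto_one_div_atTop_nhds_zero_nat (𝕜 := ℝ)
        have hlim : Tendsto (fun n : ℕ => (2 + (1 + s) * (1 / (n : ℝ))) /
            ((1 - j * (1 / (n : ℝ))) * (1 + (j + s) * (1 / (n : ℝ))))) atTop
            (nhds ((2 + (1 + s) * 0) / ((1 - j * 0) * (1 + (j + s) * 0)))) :=
          ((hinv.const_mul _).const_add _).div
            (((hinv.const_mul _).const_sub _).mul ((hinv.const_mul _).const_add _)) (by norm_num)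
        have hval : (2 + (1 + s) * 0) / ((1 - (j : ℝ) * 0) * (1 + (j + s) * 0)) = 2 := by norm_num
        rw [hval] at hlim
        refine hlim.congr' ?_
        filter_upwards [eventually_gt_atTop j] with n hn
        have hln : (j : ℝ) + 1 ≤ n := by exact_mod_cast hn
        have h1 : (n : ℝ) ≠ 0 := by linarith
        have h2 : (n : ℝ) - j ≠ 0 := by linarith
        have h3 : (n : ℝ) + (j + s) ≠ 0 := by linarith
        have h4 : (n : ℝ) * (n + s) - j * (j + s) = (n - j) * (n + (j + s)) := by ring
        have h5 : β + 1 + j ≠ 0 := by linarith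
        rw [h4, div_div_div_cancel_right₀ (by positivity)]
        have h6 : (1 - j * (1 / (n : ℝ))) = (n - j) / n := by field_simp
        have h7 : (1 + (j + s) * (1 / (n : ℝ))) = (n + (j + s)) / n := by field_simp
        rw [h6, h7]
        push_cast
        field_simp
        ring
    have := ih.mul h
    rw [show jacobiEndpointFactor s β (j + 1) = fun n : ℕ => jacobiEndpointFactor s β j n *
        (((n : ℝ) * (n + s) - j * (j + s)) / (2 * (β + 1 + j))) from
      funext fun n => Finset.prod_range_succ _ _]
    push_cast
    rwa [mul_add_one]

end JacobiOperator

namespace IsOrthogonalSequence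

variable {L : ℝ[X] →ₗ[ℝ] ℝ} {R : ℕ → ℝ[X]} {s β : ℝ}

theorem jacobiOperator_eq {d : ℝ} (hR : IsOrthogonalSequence L R)
    (hL : ∀ p : ℝ[X], p ≠ 0 → 0 < L (p * p))
    (hP : ∀ p : ℝ[X], L ((1 - X ^ 2) * derivative p + (C d - C (s + 1) * X) * p) = 0)
    (n : ℕ) : jacobiOperator s d (R n) = -(C ((n : ℝ) * (n + s)) * R n) := by
  set E := jacobiOperator s d (R n) + C ((n : ℝ) * (n + s)) * R n with hE
  have hdeg : E.degree < n := by
    rw [degree_lt_iff_coeff_zero]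
    intro m hm
    have h : ∀ k, n < k → (R n).coeff k = 0 := fun k hk =>
      coeff_eq_zero_of_natDegree_lt (by rwa [hR.natDegree_eq])
    rw [hE, coeff_add, coeff_jacobiOperator, coeff_C_mul, h (m + 1) (by omega),
      h (m + 2) (by omega)]
    rcases hm.eq_or_lt with rfl | hm
    · ring
    · rw [h m hm]
      ring
  have hzero : L (E * E) = 0 := by
    have h : E * E = ((1 - X ^ 2) * derivative (derivative (R n) * E - R n * derivative E)
        + (C d - C (s + 1) * X) * (derivative (R n) * E - R n * derivative E))
        + R n * (jacobiOperator s d E + C ((n : ℝ) * (n + s)) * E) := by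
      conv_lhs => lhs; rw [hE]
      simp only [jacobiOperator, derivative_sub, derivative_mul]
      ring
    rw [h, map_add, hP, hR.orthogonal, zero_add]
    refine (degree_add_le _ _).trans_lt (max_lt (degree_jacobiOperator_lt hdeg) ?_)
    rw [← smul_eq_C_mul]
    exact (degree_smul_le _ _).trans_lt hdeg
  have : E = 0 := by
    by_contra h
    exact (hL E h).ne' hzero
  exact eq_neg_of_add_eq_zero_left this

theorem eval_iterate_derivative_succ (hR : IsOrthogonalSequence L R)
    (hL : ∀ p : ℝ[X], p ≠ 0 → 0 < L (p * p))
    (hP : ∀ p : ℝ[X],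
      L ((1 - X ^ 2) * derivative p + (C (2 * β + 1 - s) - C (s + 1) * X) * p) = 0)
    (hβ : -1 < β) (n j : ℕ) :
    (derivative^[j + 1] (R n)).eval (-1) =
      -(((n : ℝ) * (n + s) - j * (j + s)) / (2 * (β + 1 + j)))
        * (derivative^[j] (R n)).eval (-1) := by
  have h := congrArg (eval (-1)) (iterate_derivative_jacobiOperator s (2 * β + 1 - s) (R n) j)
  rw [hR.jacobiOperator_eq hL hP, ← neg_mul, ← C_neg, iterate_derivative_C_mul] at h
  simp only [eval_mul, eval_sub, eval_add, eval_one, eval_pow, eval_X, eval_C] at h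
  have hj : β + 1 + j ≠ 0 := by
    have : (0 : ℝ) ≤ j := by positivity
    linarith
  field_simp
  linear_combination (-1) * h

theorem eval_iterate_derivative_eq (hR : IsOrthogonalSequence L R)
    (hL : ∀ p : ℝ[X], p ≠ 0 → 0 < L (p * p))
    (hP : ∀ p : ℝ[X],
      L ((1 - X ^ 2) * derivative p + (C (2 * β + 1 - s) - C (s + 1) * X) * p) = 0)
    (hβ : -1 < β) (n j : ℕ) :
    (derivative^[j] (R n)).eval (-1) =
      (-1) ^ j * jacobiEndpointFactor s β j n * (R n).eval (-1) := by
  induction j with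
  | zero => simp [jacobiEndpointFactor]
  | succ j ih =>
    rw [hR.eval_iterate_derivative_succ hL hP hβ, ih, jacobiEndpointFactor, jacobiEndpointFactor,
      Finset.prod_range_succ]
    ring

theorem eval_neg_one_ne_zero (hR : IsOrthogonalSequence L R)
    (hL : ∀ p : ℝ[X], p ≠ 0 → 0 < L (p * p))
    (hP : ∀ p : ℝ[X],
      L ((1 - X ^ 2) * derivative p + (C (2 * β + 1 - s) - C (s + 1) * X) * p) = 0)
    (hβ : -1 < β) (n : ℕ) : (R n).eval (-1) ≠ 0 := by
  intro h0
  have h : n < (R n).rootMultiplicity (-1) :=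
    (lt_rootMultiplicity_iff_isRoot_iterate_derivative (hR.ne_zero n)).2 fun m _ => by
      rw [IsRoot, hR.eval_iterate_derivative_eq hL hP hβ, h0, mul_zero]
  have h2 := (R n).card_roots'
  have h3 := Multiset.count_le_card (-1) (R n).roots
  rw [count_roots] at h3
  rw [hR.natDegree_eq] at h2
  omega

/-- The ratio of consecutive squared norms, for the normalization `R n (-1) = 1`. -/
theorem norm_ratio (hR : IsOrthogonalSequence L R)
    (hL : ∀ p : ℝ[X], p ≠ 0 → 0 < L (p * p))
    (hP : ∀ p : ℝ[X],
      L ((1 - X ^ 2) * derivative p + (C (2 * β + 1 - s) - C (s + 1) * X) * p) = 0)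
    (hβ : -1 < β) (hβs : β < s) (hone : ∀ n, (R n).eval (-1) = 1) {n : ℕ} (hn : 1 ≤ n) :
    (1 / L (R (n + 1) * R (n + 1))) / (1 / L (R n * R n)) =
      ((β + 1 + n) * (n + s) * (2 * n + 2 + s))
        / ((2 * n + s) * (n + 1) * (n + s - β)) := by
  have hκ : β + 1 ≠ 0 := by linarith
  have hκ' : β + 2 ≠ 0 := by linarith
  have d1 : ∀ m : ℕ, (derivative (R m)).eval (-1) = -((m * (m + s)) / (2 * (β + 1))) := by
    intro m
    have := hR.eval_iterate_derivative_eq hL hP hβ m 1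
    rw [hone] at this
    simpa [jacobiEndpointFactor] using this
  have d2 : ∀ m : ℕ, (derivative (derivative (R m))).eval (-1) =
      (m * (m + s)) * (m * (m + s) - (1 + s)) / (4 * (β + 1) * (β + 2)) := by
    intro m
    have := hR.eval_iterate_derivative_eq hL hP hβ m 2
    rw [hone] at this
    simp only [jacobiEndpointFactor, Finset.prod_range_succ, Finset.prod_range_zero] at this
    simp only [Function.iterate_succ_apply', Function.iterate_zero, id] at this
    rw [this, Nat.cast_zero, Nat.cast_one, show β + 1 + 1 = β + 2 by ring, add_zero]
    field_simp
    ring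
  have key : ∀ m : ℕ,
      L ((X + 1) * R (m + 1) * R (m + 2)) / L (R (m + 2) * R (m + 2))
        * ((2 * m + 2 + s) * (2 * m + 3 + s)) = -2 * (β + m + 2) * (m + 1 + s) ∧
      L ((X + 1) * R m * R (m + 1)) / L (R m * R m)
        * ((2 * m + 2 + s) * (2 * m + 1 + s)) = -2 * (m + 1) * (m + s - β) := by
    intro m
    obtain ⟨b, hb⟩ := hR.mul_eq hL m
    set A := L ((X + 1) * R (m + 1) * R (m + 2)) / L (R (m + 2) * R (m + 2))
    set B := L ((X + 1) * R m * R (m + 1)) / L (R m * R m)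
    have e0 := congrArg (eval (-1)) hb
    have e1 := congrArg (fun p => eval (-1) (derivative p)) hb
    have e2 := congrArg (fun p => eval (-1) (derivative (derivative p))) hb
    simp only [derivative_add, derivative_mul, derivative_X, derivative_one, derivative_smul,
      eval_add, eval_mul, eval_X, eval_one, eval_smul, smul_eq_mul, hone, d1, d2,
      derivative_zero, eval_zero] at e0 e1 e2
    have hb' : b = -A - B := by linarith
    subst hb'
    push_cast at e1 e2
    field_simp at e1 e2
    have f1 : A * (2 * m + 3 + s) - B * (2 * m + 1 + s) = -2 * (β + 1) := by
      linear_combination e1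
    have f2 : A * (2 * m + 3 + s) * ((m + 2) * (m + 2 + s) + (m + 1) * (m + 1 + s) - (1 + s))
        - B * (2 * m + 1 + s) * ((m + 1) * (m + 1 + s) + m * (m + s) - (1 + s))
        = -4 * (β + 2) * ((m + 1) * (m + 1 + s)) := by
      linear_combination (-1 / 2) * e2
    constructor
    · linear_combination (1 / 2) * f2
        - (1 / 2) * ((m + 1) * (m + 1 + s) + m * (m + s) - (1 + s)) * f1
    · linear_combination (1 / 2) * f2
        - (1 / 2) * ((m + 2) * (m + 2 + s) + (m + 1) * (m + 1 + s) - (1 + s)) * f1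
  obtain ⟨m, rfl⟩ : ∃ m, n = m + 1 := ⟨n - 1, by omega⟩
  have h1 := (key m).1
  have h2 := (key (m + 1)).2
  have hn1 := (hL _ (hR.ne_zero (m + 1))).ne'
  have hn2 := (hL _ (hR.ne_zero (m + 2))).ne'
  have hm : (0 : ℝ) ≤ m := by positivity
  have g1 : 2 * ((m + 1 : ℕ) : ℝ) + s ≠ 0 := by push_cast; linarith
  have g2 : ((m + 1 : ℕ) : ℝ) + 1 ≠ 0 := by positivity
  have g3 : ((m + 1 : ℕ) : ℝ) + s - β ≠ 0 := by push_cast; linarith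
  rw [div_mul_eq_mul_div, div_eq_iff hn2] at h1
  rw [div_mul_eq_mul_div, div_eq_iff hn1] at h2
  rw [one_div, one_div, inv_div_inv, div_eq_div_iff hn2 (mul_ne_zero (mul_ne_zero g1 g2) g3)]
  push_cast at *
  linear_combination (1 / 2) * (2 * m + 2 + s) * h2 - (1 / 2) * (2 * m + 4 + s) * h1

theorem hasGrowthIndex_inv_norm (hR : IsOrthogonalSequence L R)
    (hL : ∀ p : ℝ[X], p ≠ 0 → 0 < L (p * p))
    (hP : ∀ p : ℝ[X],
      L ((1 - X ^ 2) * derivative p + (C (2 * β + 1 - s) - C (s + 1) * X) * p) = 0)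
    (hβ : -1 < β) (hβs : β < s) (hone : ∀ n, (R n).eval (-1) = 1) :
    HasGrowthIndex (fun n => 1 / L (R n * R n)) (2 * β + 1) := by
  refine ⟨Eventually.of_forall fun n => one_div_pos.2 (hL _ (hR.ne_zero n)), ?_⟩
  have hinv := tendsto_one_div_atTop_nhds_zero_nat (𝕜 := ℝ)
  set c₁ : ℝ := 2 * (β + 1) * s + (β + 1 + s) * (2 + s) - 2 * (s - β) - s * (1 + s - β)
  set c₀ : ℝ := (β + 1) * s * (2 + s) - s * (s - β)
  have hlim : Tendsto (fun n : ℕ =>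
      ((2 + 4 * β) + c₁ * (1 / (n : ℝ)) + c₀ * ((1 / (n : ℝ)) * (1 / (n : ℝ))))
        / ((2 + s * (1 / (n : ℝ))) * (1 + 1 * (1 / (n : ℝ))) * (1 + (s - β) * (1 / (n : ℝ)))))
      atTop (nhds (((2 + 4 * β) + c₁ * 0 + c₀ * (0 * 0))
        / ((2 + s * 0) * (1 + 1 * 0) * (1 + (s - β) * 0)))) :=
    (((hinv.const_mul _).const_add _).add ((hinv.mul hinv).const_mul _)).div
      ((((hinv.const_mul _).const_add _).mul ((hinv.const_mul _).const_add _)).mul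
        ((hinv.const_mul _).const_add _)) (by norm_num)
  rw [show ((2 + 4 * β) + c₁ * 0 + c₀ * (0 * 0))
    / ((2 + s * 0) * (1 + 1 * 0) * (1 + (s - β) * 0)) = 2 * β + 1 by ring] at hlim
  refine hlim.congr' ?_
  filter_upwards [eventually_ge_atTop 1] with n hn
  rw [hR.norm_ratio hL hP hβ hβs hone hn]
  have hn' : (1 : ℝ) ≤ n := by exact_mod_cast hn
  have h0 : (n : ℝ) ≠ 0 := by linarith
  have h1 : 2 * (n : ℝ) + s ≠ 0 := by linarith
  have h2 : (n : ℝ) + 1 ≠ 0 := by linarith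
  have h3 : (n : ℝ) + s - β ≠ 0 := by linarith
  rw [show 2 + s * (1 / (n : ℝ)) = (2 * n + s) / n by field_simp,
    show 1 + 1 * (1 / (n : ℝ)) = (n + 1) / n by field_simp,
    show 1 + (s - β) * (1 / (n : ℝ)) = (n + s - β) / n by field_simp; ring]
  simp only [c₁, c₀]
  field_simp
  ring

end IsOrthogonalSequence

/-- Continuity of the solution of a symmetric two by two linear system at the matrix with entries
`1 / (2 * (β + 1 + i + j))`. -/
theorem tendsto_of_linear_system {β : ℝ} (hβ : -1 < β) {p q r x y : ℕ → ℝ}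
    (hp : Tendsto p atTop (nhds (1 / (2 * (β + 1)))))
    (hq : Tendsto q atTop (nhds (1 / (2 * (β + 2)))))
    (hr : Tendsto r atTop (nhds (1 / (2 * (β + 3)))))
    (h₁ : ∀ᶠ n in atTop, x n * p n + y n * q n = 1)
    (h₂ : ∀ᶠ n in atTop, x n * q n + y n * r n = 1) :
    Tendsto x atTop (nhds (-2 * (β + 1) * (β + 2))) ∧
      Tendsto y atTop (nhds (2 * (β + 2) * (β + 3))) := by
  have e1 : β + 1 ≠ 0 := by linarith
  have e2 : β + 2 ≠ 0 := by linarith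
  have e3 : β + 3 ≠ 0 := by linarith
  have hdet := (hp.mul hr).sub (hq.mul hq)
  rw [show 1 / (2 * (β + 1)) * (1 / (2 * (β + 3))) - 1 / (2 * (β + 2)) * (1 / (2 * (β + 2)))
    = 1 / (4 * (β + 1) * (β + 2) ^ 2 * (β + 3)) by field_simp; ring] at hdet
  have hdet0 : 1 / (4 * (β + 1) * (β + 2) ^ 2 * (β + 3)) ≠ 0 := by positivity
  constructor
  · have h := (hr.sub hq).div hdet hdet0
    rw [show (1 / (2 * (β + 3)) - 1 / (2 * (β + 2))) / (1 / (4 * (β + 1) * (β + 2) ^ 2 * (β + 3)))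
      = -2 * (β + 1) * (β + 2) by field_simp; ring] at h
    refine h.congr' ?_
    filter_upwards [h₁, h₂, hdet.eventually_ne hdet0] with n e₁ e₂ hne
    rw [Pi.div_apply, div_eq_iff hne]
    linear_combination q n * e₂ - r n * e₁
  · have h := (hp.sub hq).div hdet hdet0
    rw [show (1 / (2 * (β + 1)) - 1 / (2 * (β + 2))) / (1 / (4 * (β + 1) * (β + 2) ^ 2 * (β + 3)))
      = 2 * (β + 2) * (β + 3) by field_simp; ring] at h
    refine h.congr' ?_
    filter_upwards [h₁, h₂, hdet.eventually_ne hdet0] with n e₁ e₂ hne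
    rw [Pi.div_apply, div_eq_iff hne]
    linear_combination q n * e₁ - p n * e₂

/-- The derivative asymptotics in the normalization `R n (-1) = 1`. -/
theorem IsOrthogonalSequence.tendsto_sobolev_ratio {L : ℝ[X] →ₗ[ℝ] ℝ} {R : ℕ → ℝ[X]} {s β : ℝ}
    (hR : IsOrthogonalSequence L R) (hL : ∀ p : ℝ[X], p ≠ 0 → 0 < L (p * p))
    (hP : ∀ p : ℝ[X],
      L ((1 - X ^ 2) * derivative p + (C (2 * β + 1 - s) - C (s + 1) * X) * p) = 0)
    (hβ : -1 < β) (hβs : β < s) (hone : ∀ n, (R n).eval (-1) = 1)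
    {M N : ℝ} (hM : 0 < M) (hN : 0 < N) {q : ℕ → ℝ[X]}
    (hq : ∀ n : ℕ, 1 ≤ n → (q n - R n).degree < n)
    (hort : ∀ n k, k < n → L (q n * R k) + M * (q n).eval (-1) * (R k).eval (-1)
      + N * (derivative (q n)).eval (-1) * (derivative (R k)).eval (-1) = 0) (j : ℕ) :
    Tendsto (fun n => (derivative^[j] (q n)).eval (-1) / (derivative^[j] (R n)).eval (-1)) atTop
      (nhds (j * (j - 1) / ((β + j + 1) * (β + j + 2)))) := by
  have hs : -1 < s := hβ.trans hβs
  set ρ := jacobiEndpointFactor s β with hρ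
  set a : ℕ → ℝ := fun n => 1 / L (R n * R n)
  have hapos : ∀ n, 0 < a n := fun n => one_div_pos.2 (hL _ (hR.ne_zero n))
  have hρ0 : ∀ n, ρ 0 n = 1 := fun n => by simp [hρ, jacobiEndpointFactor]
  have hderiv : ∀ n i, (derivative^[i] (R n)).eval (-1) = (-1) ^ i * ρ i n := fun n i => by
    rw [hR.eval_iterate_derivative_eq hL hP hβ, hone, mul_one]
  have hρpos : ∀ i, ∀ᶠ n in atTop, 0 < ρ i n := fun i =>
    (hasGrowthIndex_jacobiEndpointFactor hs hβ i).1
  have hb0 : ∀ i k n, 0 ≤ a n * (ρ i n * ρ k n) := fun i k n =>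
    mul_nonneg (hapos n).le (mul_nonneg (jacobiEndpointFactor_nonneg hs hβ i n)
      (jacobiEndpointFactor_nonneg hs hβ k n))
  have hbi : ∀ i k : ℕ, HasGrowthIndex (fun n => a n * (ρ i n * ρ k n))
      (2 * β + 1 + (2 * i + 2 * k)) := fun i k =>
    (hR.hasGrowthIndex_inv_norm hL hP hβ hβs hone).mul
      ((hasGrowthIndex_jacobiEndpointFactor hs hβ i).mul
        (hasGrowthIndex_jacobiEndpointFactor hs hβ k))
  have hgt : ∀ i k : ℕ, -1 < 2 * β + 1 + (2 * (i : ℝ) + 2 * k) := fun i k => by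
    have h1 : (0 : ℝ) ≤ i := by positivity
    have h2 : (0 : ℝ) ≤ k := by positivity
    linarith
  set S : ℕ → ℕ → ℕ → ℝ := fun i k n => ∑ m ∈ Finset.range n, a m * (ρ i m * ρ k m) with hS
  set σ : ℕ → ℕ → ℕ → ℝ := fun i k n => S i k n / (n * (a n * (ρ i n * ρ k n))) with hσ
  have hσlim : ∀ i k : ℕ, Tendsto (σ i k) atTop (nhds (1 / (2 * (β + 1 + (i + k))))) := fun i k => by
    have := (hbi i k).tendsto_sum_div_mul (hgt i k) (hb0 i k)
    rwa [show 2 * β + 1 + (2 * (i : ℝ) + 2 * k) + 1 = 2 * (β + 1 + (i + k)) by ring] at this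
  have hinf : ∀ i k : ℕ, Tendsto (fun n : ℕ => (n : ℝ) * (a n * (ρ i n * ρ k n))) atTop atTop :=
    fun i k => (hbi i k).tendsto_mul_atTop (hgt i k) (hb0 i k)
  set x : ℕ → ℝ := fun n => M * (q n).eval (-1) * (n * a n) with hx
  set y : ℕ → ℝ := fun n => -N * (derivative (q n)).eval (-1) * (n * a n * ρ 1 n) with hy
  have hexp : ∀ i, ∀ᶠ n in atTop,
      (derivative^[i] (q n)).eval (-1) / (derivative^[i] (R n)).eval (-1)
        = 1 - x n * σ 0 i n - y n * σ 1 i n := by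
    intro i
    filter_upwards [eventually_ge_atTop 1, hρpos i, hρpos 1] with n hn hi h1
    have hcoef : ∀ k ∈ Finset.range n, (L ((q n - R n) * R k) / L (R k * R k)) • R k =
        (a k * (-M * (q n).eval (-1) + N * (derivative (q n)).eval (-1) * ρ 1 k)) • R k := by
      intro k hk
      have hkn := Finset.mem_range.1 hk
      have h2 := hort n k hkn
      have h3 : (derivative (R k)).eval (-1) = -ρ 1 k := by simpa using hderiv k 1
      rw [hone, h3] at h2
      rw [sub_mul, map_sub, hR.apply_mul_of_ne hkn.ne', sub_zero, div_eq_mul_one_div, mul_comm]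
      congr 2
      linear_combination h2
    have hexpand : (derivative^[i] (q n)).eval (-1) = (-1) ^ i * ρ i n
        + ∑ k ∈ Finset.range n, (a k * (-M * (q n).eval (-1)
          + N * (derivative (q n)).eval (-1) * ρ 1 k)) * ((-1) ^ i * ρ i k) := by
      have h := hR.eq_sum hL n _ (hq n hn)
      rw [Finset.sum_congr rfl hcoef, sub_eq_iff_eq_add'] at h
      conv_lhs => rw [h]
      rw [iterate_map_add, iterate_derivative_sum, eval_add, eval_finsetSum, hderiv]
      simp only [iterate_derivative_smul, eval_smul, smul_eq_mul, hderiv]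
    have hsum : ∑ k ∈ Finset.range n, (a k * (-M * (q n).eval (-1)
          + N * (derivative (q n)).eval (-1) * ρ 1 k)) * ((-1) ^ i * ρ i k)
        = (-1) ^ i * (-M * (q n).eval (-1) * S 0 i n
          + N * (derivative (q n)).eval (-1) * S 1 i n) := by
      simp only [hS, Finset.mul_sum, ← Finset.sum_add_distrib]
      refine Finset.sum_congr rfl fun k _ => ?_
      rw [hρ0]
      ring
    have hn0 : (n : ℝ) ≠ 0 := by positivity
    have ha0 := (hapos n).ne'
    rw [hexpand, hsum, hderiv, ← mul_add, mul_div_mul_left _ _ (pow_ne_zero i (by norm_num))]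
    simp only [hx, hy, hσ, hρ0]
    field_simp
    ring
  have hlimxy := tendsto_of_linear_system hβ (x := x) (y := y)
    (p := fun n => σ 0 0 n + 1 / M * ((n : ℝ) * (a n * (ρ 0 n * ρ 0 n)))⁻¹) (q := σ 0 1)
    (r := fun n => σ 1 1 n + 1 / N * ((n : ℝ) * (a n * (ρ 1 n * ρ 1 n)))⁻¹)
    (by simpa using (hσlim 0 0).add ((hinf 0 0).inv_tendsto_atTop.const_mul (1 / M)))
    (by convert hσlim 0 1 using 3; push_cast; ring)
    (by
      have h : Tendsto (fun n => σ 1 1 n + 1 / N * ((n : ℝ) * (a n * (ρ 1 n * ρ 1 n)))⁻¹) atTop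
          (nhds _) := (hσlim 1 1).add ((hinf 1 1).inv_tendsto_atTop.const_mul (1 / N))
      rwa [mul_zero, add_zero,
        show β + 1 + (((1 : ℕ) : ℝ) + ((1 : ℕ) : ℝ)) = β + 3 by push_cast; ring] at h)
    (by
      filter_upwards [hexp 0, eventually_gt_atTop 0] with n h hn
      have hn0 : (n : ℝ) ≠ 0 := by positivity
      have ha0 := (hapos n).ne'
      have hx' : x n * (1 / M * ((n : ℝ) * (a n * (ρ 0 n * ρ 0 n)))⁻¹) = (q n).eval (-1) := by
        simp only [hx, hρ0]
        field_simp
      have hsymm : σ 1 0 n = σ 0 1 n := by simp only [hσ, hS, mul_comm (ρ 1 _)]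
      simp only [Function.iterate_zero, id, hone, div_one] at h
      rw [mul_add, hx', h, hsymm]
      ring)
    (by
      filter_upwards [hexp 1, eventually_gt_atTop 0, hρpos 1] with n h hn h1
      have hn0 : (n : ℝ) ≠ 0 := by positivity
      have ha0 := (hapos n).ne'
      have hy' : y n * (1 / N * ((n : ℝ) * (a n * (ρ 1 n * ρ 1 n)))⁻¹)
          = (derivative (q n)).eval (-1) / (-ρ 1 n) := by
        simp only [hy]
        field_simp
      have h3 : (derivative (R n)).eval (-1) = -ρ 1 n := by simpa using hderiv n 1
      simp only [Function.iterate_one, h3] at h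
      rw [mul_add (y n), hy', h]
      ring)
  have hfin := ((hlimxy.1.mul (hσlim 0 j)).const_sub 1).sub (hlimxy.2.mul (hσlim 1 j))
  have hj : (0 : ℝ) ≤ j := by positivity
  have e1 : β + j + 1 ≠ 0 := by linarith
  have e2 : β + j + 2 ≠ 0 := by linarith
  rw [show 1 - -2 * (β + 1) * (β + 2) * (1 / (2 * (β + 1 + (((0 : ℕ) : ℝ) + j))))
      - 2 * (β + 2) * (β + 3) * (1 / (2 * (β + 1 + (((1 : ℕ) : ℝ) + j))))
      = j * (j - 1) / ((β + j + 1) * (β + j + 2)) by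
    rw [show β + 1 + (((0 : ℕ) : ℝ) + j) = β + j + 1 by push_cast; ring,
      show β + 1 + (((1 : ℕ) : ℝ) + j) = β + j + 2 by push_cast; ring]
    field_simp
    ring] at hfin
  exact hfin.congr' ((hexp j).mono fun n h => h.symm)

theorem isOrthogonalSequence_of_integral {α β : ℝ} (hα : -1 < α) (hβ : -1 < β) {P : ℕ → ℝ[X]}
    (hne : ∀ n, P n ≠ 0) (hdeg : ∀ n, (P n).natDegree = n)
    (horth : ∀ n k, k < n →
      ∫ x in Set.Ioo (-1 : ℝ) 1, (P n).eval x * x ^ k * (1 - x) ^ α * (1 + x) ^ β = 0) :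
    IsOrthogonalSequence (jacobiFunctional hα hβ) P where
  ne_zero := hne
  natDegree_eq := hdeg
  orthogonal n q hq := by
    have hX : ∀ k, k < n → jacobiFunctional hα hβ (P n * X ^ k) = 0 := fun k hk => by
      rw [← horth n k hk]
      change ∫ x in Set.Ioo (-1 : ℝ) 1, _ = _
      simp only [eval_mul, eval_pow, eval_X, mul_assoc]
    rw [q.as_sum_support_C_mul_X_pow, Finset.mul_sum, map_sum]
    refine Finset.sum_eq_zero fun k hk => ?_
    have hk' : k < n := by
      have := (le_degree_of_mem_supp k hk).trans_lt hq
      exact_mod_cast this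
    rw [← smul_eq_C_mul, mul_smul_comm, map_smul, hX k hk', smul_zero]

theorem sobolev_jacobi_derivative_ratio_asymptotics
    (α β : ℝ) (hα : -1 < α) (hβ : -1 < β) (j : ℕ)
    (Pt : ℕ → ℝ[X])
    (hdeg : ∀ n, (Pt n).natDegree = n)
    (hone : ∀ n, (Pt n).eval 1 = 1)
    (horth : ∀ n k, k < n →
      ∫ x in Set.Ioo (-1 : ℝ) 1, (Pt n).eval x * x ^ k * (1 - x) ^ α * (1 + x) ^ β = 0)
    (M N : ℝ) (hM : 0 < M) (hN : 0 < N)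
    (innS : ℝ[X] → ℝ[X] → ℝ)
    (hinnS : ∀ p q : ℝ[X], innS p q
      = (∫ x in Set.Ioo (-1 : ℝ) 1, p.eval x * q.eval x * (1 - x) ^ α * (1 + x) ^ β)
        + M * p.eval (-1) * q.eval (-1)
        + N * (derivative p).eval (-1) * (derivative q).eval (-1))
    (Q : ℕ → ℝ[X])
    (hQdeg : ∀ n, (Q n).natDegree = n)
    (hQlead : ∀ n, (Q n).leadingCoeff = (Pt n).leadingCoeff)
    (hQorth : ∀ n, ∀ p : ℝ[X], p.natDegree < n → innS (Q n) p = 0)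
    : Tendsto (fun n : ℕ =>
        ((⇑(derivative (R := ℝ)))^[j] (Q n)).eval (-1)
          / ((⇑(derivative (R := ℝ)))^[j] (Pt n)).eval (-1))
      atTop
      (nhds ((j : ℝ) * ((j : ℝ) - 1) / ((β + j + 1) * (β + j + 2)))) := by
  have hne : ∀ n, Pt n ≠ 0 := fun n h => by simpa [h] using hone n
  have hPt := isOrthogonalSequence_of_integral hα hβ hne hdeg horth
  have hL : ∀ p : ℝ[X], p ≠ 0 → 0 < jacobiFunctional hα hβ (p * p) := fun p hp =>
    jacobiFunctional_mul_self_pos hα hβ hp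
  have hP : ∀ p : ℝ[X], jacobiFunctional hα hβ ((1 - X ^ 2) * derivative p
      + (C (2 * β + 1 - (α + β + 1)) - C (α + β + 1 + 1) * X) * p) = 0 := fun p => by
    rw [show 2 * β + 1 - (α + β + 1) = β - α by ring, show α + β + 1 + 1 = α + β + 2 by ring]
    exact jacobiFunctional_pearson hα hβ p
  have hμ : ∀ n, (Pt n).eval (-1) ≠ 0 := hPt.eval_neg_one_ne_zero hL hP hβ
  set c : ℕ → ℝ := fun n => ((Pt n).eval (-1))⁻¹ with hc
  have hc0 : ∀ n, c n ≠ 0 := fun n => inv_ne_zero (hμ n)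
  have hmain := (hPt.smul hc0).tendsto_sobolev_ratio hL hP hβ (by linarith)
    (fun n => by simp [hc, hμ]) hM hN (q := fun n => c n • Q n) ?_ ?_ j
  · refine hmain.congr fun n => ?_
    simp only [iterate_derivative_smul, eval_smul, smul_eq_mul]
    exact mul_div_mul_left _ _ (hc0 n)
  · intro n hn
    have hQne : Q n ≠ 0 := by
      intro h
      have := hQdeg n
      rw [h, natDegree_zero] at this
      omega
    have hQd : (Q n).degree = n := by rw [degree_eq_natDegree hQne, hQdeg]
    rw [← smul_sub]
    refine (degree_smul_le _ _).trans_lt ?_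
    rw [← hQd]
    exact degree_sub_lt_left (by rw [hQd, hPt.degree_eq]) hQne (hQlead n)
  · intro n k hk
    have h := hQorth n (Pt k) (by rwa [hdeg])
    have hint : ∫ x in Set.Ioo (-1 : ℝ) 1, (Q n).eval x * (Pt k).eval x * (1 - x) ^ α * (1 + x) ^ β
        = jacobiFunctional hα hβ (Q n * Pt k) := by
      change _ = ∫ x in Set.Ioo (-1 : ℝ) 1, _
      simp only [eval_mul, mul_assoc]
    rw [hinnS, hint] at h
    simp only [smul_mul_smul_comm, map_smul, eval_smul, smul_eq_mul]
    linear_combination c n * c k * h
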